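/- Let (φ, D) be a solution of φ'' = λ·φ·m in integral form on an interval I containing 0, with λ > 0, φ(0) = 1 and D(0) = 0. Then φ(x) ≥ 1 for every x ∈ I; moreover φ is nondecreasing on I ∩ [0,∞) and nonincreasing on I ∩ (−∞,0]. -/

import Mathlib

open MeasureTheory Filter Set

/-- A pair `(f, D)` is a solution of `f'' = λ·f·m` in integral form on `S`:
`f y − f x = ∫_x^y D(t) dt` and `D y − D x = λ ∫_{(x,y]} f dm` for all `x ≤ y` in `S`. -/
def IsIntegralSolution (m : MeasureTheory.Measure ℝ) (lam : ℝ) (S : Set ℝ)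
    (f D : ℝ → ℝ) : Prop :=
  (∀ x ∈ S, ∀ y ∈ S, x ≤ y → f y - f x = ∫ t in x..y, D t) ∧
  (∀ x ∈ S, ∀ y ∈ S, x ≤ y → D y - D x = lam * ∫ t in Set.Ioc x y, f t ∂m)

/-- If `f` has increments `∫ D`, starts positive, and `D` is nonnegative at the end of every
initial interval on which `f` is nonnegative, then `f` is monotone. No integrability of `D` is
needed, since both the integral of a nonnegative function and the default value `0` are
nonnegative. -/
theorem monotoneOn_Icc_of_integral_increments {f D : ℝ → ℝ} {a b : ℝ} (ha : 0 < f a)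
    (hf : ∀ x ∈ Icc a b, ∀ y ∈ Icc a b, x ≤ y → f y - f x = ∫ t in x..y, D t)
    (hD : ∀ y ∈ Icc a b, (∀ t ∈ Icc a y, 0 ≤ f t) → 0 ≤ D y) :
    MonotoneOn f (Icc a b) := by
  have mono : ∀ x ∈ Icc a b, ∀ y ∈ Icc a b, x ≤ y → (∀ t ∈ Ico a y, 0 ≤ f t) → f x ≤ f y := by
    intro x hx y hy hxy hpos
    have hnonneg : 0 ≤ ∫ t in x..y, D t := by
      rw [intervalIntegral.integral_of_le hxy, integral_Ioc_eq_integral_Ioo]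
      refine setIntegral_nonneg measurableSet_Ioo fun t ht => ?_
      exact hD t ⟨hx.1.trans ht.1.le, ht.2.le.trans hy.2⟩
        fun u hu => hpos u ⟨hu.1, hu.2.trans_lt ht.2⟩
    linarith [hf x hx y hy hxy]
  suffices hall : ∀ t ∈ Icc a b, 0 ≤ f t from
    fun x hx y hy hxy => mono x hx y hy hxy fun t ht => hall t ⟨ht.1, ht.2.le.trans hy.2⟩
  rcases lt_or_ge b a with hab | hab
  · exact fun t ht => absurd (ht.1.trans ht.2) (not_le.2 hab)
  set S : Set ℝ := {x ∈ Icc a b | ∀ t ∈ Icc a x, 0 ≤ f t}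
  have haS : a ∈ S := ⟨⟨le_rfl, hab⟩, fun t ht => by rw [le_antisymm ht.2 ht.1]; exact ha.le⟩
  have hbdd : BddAbove S := ⟨b, fun x hx => hx.1.2⟩
  set s := sSup S
  have has : a ≤ s := le_csSup hbdd haS
  have hsb : s ≤ b := csSup_le ⟨a, haS⟩ fun x hx => hx.1.2
  have hlt : ∀ t ∈ Ico a s, 0 ≤ f t := by
    intro t ht
    obtain ⟨x, hx, htx⟩ := exists_lt_of_lt_csSup ⟨a, haS⟩ ht.2
    exact hx.2 t ⟨ht.1, htx.le⟩
  have hfs : 0 < f s := ha.trans_le (mono a ⟨le_rfl, hab⟩ s ⟨has, hsb⟩ has hlt)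
  have extend : ∀ y ∈ Icc s b, (∀ t ∈ Icc s y, 0 ≤ f t) → y ∈ S := fun y hy h =>
    ⟨⟨has.trans hy.1, hy.2⟩, fun t ht => (lt_or_ge t s).elim (fun h' => hlt t ⟨ht.1, h'⟩)
      fun h' => h t ⟨h', ht.2⟩⟩
  rcases hsb.eq_or_lt with hsb' | hsb'
  · have hbS : b ∈ S := extend b ⟨hsb, le_rfl⟩ fun t ht => by
      rw [le_antisymm (ht.2.trans hsb'.ge) ht.1]; exact hfs.le
    exact hbS.2
  exfalso
  obtain ⟨y, hy, hyb, hpos⟩ : ∃ y, s < y ∧ y ≤ b ∧ ∀ t ∈ Icc s y, 0 ≤ f t := by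
    have increment : ∀ t ∈ Icc s b, f t = f s + ∫ u in s..t, D u := fun t ht => by
      linarith [hf s ⟨has, hsb⟩ t ⟨has.trans ht.1, ht.2⟩ ht.1]
    by_cases hint : ∃ c, s < c ∧ c ≤ b ∧ IntervalIntegrable D volume s c
    · obtain ⟨c, hsc, hcb, hc⟩ := hint
      have hcont : ContinuousOn (fun t => f s + ∫ u in s..t, D u) (Icc s c) := by
        have := intervalIntegral.continuousOn_primitive_interval
          ((intervalIntegrable_iff' (f := D)).1 hc)
        rw [uIcc_of_le hsc.le] at this
        exact continuousOn_const.add this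
      have hev : ∀ᶠ t in nhdsWithin s (Icc s c), 0 < f s + ∫ u in s..t, D u :=
        (hcont s ⟨le_rfl, hsc.le⟩).eventually (lt_mem_nhds (by simpa using hfs))
      rw [nhdsWithin_Icc_eq_nhdsGE hsc] at hev
      obtain ⟨y, hy, hsub⟩ := (mem_nhdsGE_iff_exists_Icc_subset).1 hev
      refine ⟨min y c, lt_min hy hsc, (min_le_right _ _).trans hcb, fun t ht => ?_⟩
      rw [increment t ⟨ht.1, ht.2.trans ((min_le_right _ _).trans hcb)⟩]
      exact le_of_lt (hsub ⟨ht.1, ht.2.trans (min_le_left _ _)⟩)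
    · push Not at hint
      refine ⟨b, hsb', le_rfl, fun t ht => ?_⟩
      rcases ht.1.eq_or_lt with rfl | hst
      · exact hfs.le
      · rw [increment t ht, intervalIntegral.integral_undef (hint t hst ht.2), add_zero]
        exact hfs.le
  exact absurd (le_csSup hbdd (extend y ⟨hy.le, hyb⟩ hpos)) (not_le.2 hy)

/-- For a solution `(φ, D)` of `φ'' = λ·φ·m` on an interval `I ∋ 0` with `λ > 0`,
`φ(0) = 1` and `D(0) = 0`: `φ ≥ 1` on `I`, `φ` is nondecreasing on `I ∩ [0,∞)`
and nonincreasing on `I ∩ (−∞,0]`. -/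
theorem integral_solution_phi_ge_one
    (m : MeasureTheory.Measure ℝ) (lam : ℝ) (hlam : 0 < lam)
    (I : Set ℝ) (hI : I.OrdConnected) (h0 : (0 : ℝ) ∈ I)
    (hm : ∀ K : Set ℝ, IsCompact K → K ⊆ interior I → m K < ⊤)
    (φ D : ℝ → ℝ)
    (hsol : IsIntegralSolution m lam I φ D)
    (hφ0 : φ 0 = 1) (hD0 : D 0 = 0) :
    (∀ x ∈ I, 1 ≤ φ x) ∧
      MonotoneOn φ (I ∩ Set.Ici 0) ∧
      AntitoneOn φ (I ∩ Set.Iic 0) := by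
  obtain ⟨hφ, hD⟩ := hsol
  have hmono : MonotoneOn φ (I ∩ Ici 0) := by
    rintro x ⟨-, hx⟩ y ⟨hyI, hy⟩ hxy
    have hsub : Icc 0 y ⊆ I := hI.out h0 hyI
    refine monotoneOn_Icc_of_integral_increments (D := D) (by rw [hφ0]; exact one_pos)
      (fun u hu v hv => hφ u (hsub hu) v (hsub hv)) (fun u hu hpos => ?_)
      ⟨hx, hxy⟩ ⟨hy, le_rfl⟩ hxy
    have hinc := hD 0 h0 u (hsub hu) hu.1
    rw [hD0, sub_zero] at hinc
    rw [hinc]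
    exact mul_nonneg hlam.le
      (setIntegral_nonneg measurableSet_Ioc fun t ht => hpos t ⟨ht.1.le, ht.2⟩)
  have hanti : AntitoneOn φ (I ∩ Iic 0) := by
    rintro x ⟨hxI, hx⟩ y ⟨-, hy⟩ hxy
    have hsub : ∀ u ∈ Icc 0 (-x), -u ∈ I := fun u hu =>
      hI.out hxI h0 ⟨by linarith [hu.2], by linarith [hu.1]⟩
    have hreflect : MonotoneOn (fun u => φ (-u)) (Icc 0 (-x)) := by
      refine monotoneOn_Icc_of_integral_increments (D := fun u => -D (-u))
        (by simp [hφ0]) (fun u hu v hv huv => ?_) (fun u hu hpos => ?_)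
      · have hinc := hφ (-v) (hsub v hv) (-u) (hsub u hu) (neg_le_neg huv)
        rw [intervalIntegral.integral_neg, intervalIntegral.integral_comp_neg]
        linarith
      · have hinc := hD (-u) (hsub u hu) 0 h0 (by linarith [hu.1])
        rw [hD0, zero_sub] at hinc
        rw [hinc]
        refine mul_nonneg hlam.le (setIntegral_nonneg measurableSet_Ioc fun t ht => ?_)
        simpa using hpos (-t) ⟨by linarith [ht.2], by linarith [ht.1]⟩
    have hy0 : y ≤ 0 := hy
    have hx0 : x ≤ 0 := hx
    simpa using hreflect (a := -y) (b := -x) ⟨by linarith, by linarith⟩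
      ⟨by linarith, le_rfl⟩ (neg_le_neg hxy)
  refine ⟨fun x hx => ?_, hmono, hanti⟩
  rw [← hφ0]
  rcases le_total 0 x with h | h
  · exact hmono ⟨h0, self_mem_Ici⟩ ⟨hx, h⟩ h
  · exact hanti ⟨hx, h⟩ ⟨h0, self_mem_Iic⟩ h
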